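/- arXiv:0809.3298 — 2 statements merged into one kernel-verified Lean document; each statement's English description precedes it below -/
import Mathlib

section
/- Define f : (√2, +∞) → ℝ by f(E) = 4096·sin⁴(α)·sin²(β)·sin²(γ)·(cos α − cos β)⁴·(cos²α − cos²β)·(cos²α − cos²γ)·(−sin²(2α) + cos²β + cos²γ + 2 cos β cos γ (1 − 2cos²α))², where α = √(E−1), β = √(E−√2), γ = √(E+√2). Then f is not identically zero on (√2, +∞), and its zero set {E ∈ (√2,+∞) : f(E) = 0} is discrete, i.e. has no accumulation point in (√2, +∞). -/
open Real

noncomputable section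

/-- α = √(E-1). -/
def aE (E : ℝ) : ℝ := Real.sqrt (E - 1)

/-- β = √(E-√2). -/
def bE (E : ℝ) : ℝ := Real.sqrt (E - Real.sqrt 2)

/-- γ = √(E+√2). -/
def cE (E : ℝ) : ℝ := Real.sqrt (E + Real.sqrt 2)

/-- The determinant formula f(E). -/
def detFormula (E : ℝ) : ℝ :=
  4096 * Real.sin (aE E) ^ 4 * Real.sin (bE E) ^ 2 * Real.sin (cE E) ^ 2 *
    (Real.cos (aE E) - Real.cos (bE E)) ^ 4 *
    (Real.cos (aE E) ^ 2 - Real.cos (bE E) ^ 2) *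
    (Real.cos (aE E) ^ 2 - Real.cos (cE E) ^ 2) *
    (-Real.sin (2 * aE E) ^ 2 + Real.cos (bE E) ^ 2 + Real.cos (cE E) ^ 2 +
        2 * Real.cos (bE E) * Real.cos (cE E) * (1 - 2 * Real.cos (aE E) ^ 2)) ^ 2

/-- At the energy with `α = π / 2` the determinant formula does not vanish. -/
lemma detFormula_one_add_pi_div_two_sq_ne_zero : detFormula (1 + (π / 2) ^ 2) ≠ 0 := by
  have hs0 := Real.sqrt_nonneg 2
  have hs : Real.sqrt 2 ^ 2 = 2 := Real.sq_sqrt (by norm_num)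
  have hs1 : Real.sqrt 2 < 1.415 := by nlinarith
  have hs2 : 1.41 < Real.sqrt 2 := by nlinarith
  have hp1 := Real.pi_gt_d2
  have hp2 := Real.pi_lt_d2
  have ha : aE (1 + (π / 2) ^ 2) = π / 2 := by
    rw [aE, add_sub_cancel_left, Real.sqrt_sq (by positivity)]
  have hb1 : 1.4 < bE (1 + (π / 2) ^ 2) := Real.lt_sqrt_of_sq_lt (by nlinarith)
  have hb2 : bE (1 + (π / 2) ^ 2) < π / 2 :=
    (Real.sqrt_lt' (by positivity)).2 (by linarith)
  have hc1 : 1.8 < cE (1 + (π / 2) ^ 2) := Real.lt_sqrt_of_sq_lt (by nlinarith)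
  have hc2 : cE (1 + (π / 2) ^ 2) < π := (Real.sqrt_lt' (by positivity)).2 (by nlinarith)
  unfold detFormula
  rw [ha]
  generalize bE (1 + (π / 2) ^ 2) = b at *
  generalize cE (1 + (π / 2) ^ 2) = c at *
  have hsb : 0 < Real.sin b := Real.sin_pos_of_pos_of_lt_pi (by linarith) (by linarith)
  have hsc : 0 < Real.sin c := Real.sin_pos_of_pos_of_lt_pi (by linarith) (by linarith)
  have hcb : 0 < Real.cos b := Real.cos_pos_of_mem_Ioo ⟨by linarith, by linarith⟩
  have hcc : Real.cos c < 0 := Real.cos_neg_of_pi_div_two_lt_of_lt (by linarith) (by linarith)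
  have hbc : Real.cos b + Real.cos c < 0 := by
    have h : Real.cos b < Real.cos (π - c) :=
      Real.cos_lt_cos_of_nonneg_of_le_pi (by linarith) (by linarith) (by linarith)
    rw [Real.cos_pi_sub] at h
    linarith
  have hlast : -Real.sin (2 * (π / 2)) ^ 2 + Real.cos b ^ 2 + Real.cos c ^ 2 +
      2 * Real.cos b * Real.cos c * (1 - 2 * Real.cos (π / 2) ^ 2) =
      (Real.cos b + Real.cos c) ^ 2 := by
    rw [mul_div_cancel₀ π two_ne_zero, Real.sin_pi, Real.cos_pi_div_two]
    ring
  rw [hlast, Real.cos_pi_div_two, Real.sin_pi_div_two]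
  simp [hsb.ne', hsc.ne', hcb.ne', hcc.ne, hbc.ne]

/-- The determinant formula is real analytic on `(√2, ∞)`. -/
lemma analyticOnNhd_detFormula : AnalyticOnNhd ℝ detFormula (Set.Ioi (Real.sqrt 2)) := by
  intro x hx
  have hx : Real.sqrt 2 < x := hx
  have h1 : 1 < Real.sqrt 2 := Real.lt_sqrt_of_sq_lt (by norm_num)
  have hsqrt (d : ℝ) (hd : 0 < x + d) : AnalyticAt ℝ (fun E => Real.sqrt (E + d)) x := by
    have h : AnalyticAt ℝ Real.sqrt (x + d) :=
      (Real.contDiffAt_sqrt hd.ne').analyticAt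
    exact AnalyticAt.fun_comp (f := fun E => E + d) h (by fun_prop)
  have ha : AnalyticAt ℝ aE x := hsqrt (-1) (by linarith)
  have hb : AnalyticAt ℝ bE x := hsqrt (-Real.sqrt 2) (by linarith)
  have hc : AnalyticAt ℝ cE x := hsqrt (Real.sqrt 2) (by linarith)
  have hsin (y : ℝ) : AnalyticAt ℝ Real.sin y := Real.analyticAt_sin
  have hcos (y : ℝ) : AnalyticAt ℝ Real.cos y := Real.analyticAt_cos
  have hsa : AnalyticAt ℝ (fun E => Real.sin (aE E)) x := (hsin _).fun_comp ha
  have hsb : AnalyticAt ℝ (fun E => Real.sin (bE E)) x := (hsin _).fun_comp hb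
  have hsc : AnalyticAt ℝ (fun E => Real.sin (cE E)) x := (hsin _).fun_comp hc
  have hs2a : AnalyticAt ℝ (fun E => Real.sin (2 * aE E)) x :=
    (hsin _).fun_comp (analyticAt_const.mul ha)
  have hca : AnalyticAt ℝ (fun E => Real.cos (aE E)) x := (hcos _).fun_comp ha
  have hcb : AnalyticAt ℝ (fun E => Real.cos (bE E)) x := (hcos _).fun_comp hb
  have hcc : AnalyticAt ℝ (fun E => Real.cos (cE E)) x := (hcos _).fun_comp hc
  unfold detFormula
  fun_prop

/-- f is not identically zero on (√2, ∞) and its zero set in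
(√2, ∞) has no accumulation point in (√2, ∞). -/
theorem detFormula_not_identically_zero_and_zeros_discrete :
    (∃ E ∈ Set.Ioi (Real.sqrt 2), detFormula E ≠ 0) ∧
      ∀ x ∈ Set.Ioi (Real.sqrt 2),
        ¬ AccPt x (Filter.principal
          {E | E ∈ Set.Ioi (Real.sqrt 2) ∧ detFormula E = 0}) := by
  have hmem : 1 + (π / 2) ^ 2 ∈ Set.Ioi (Real.sqrt 2) :=
    (Real.sqrt_lt' (by positivity)).2 (by nlinarith [Real.pi_gt_three])
  refine ⟨⟨_, hmem, detFormula_one_add_pi_div_two_sq_ne_zero⟩, fun x hx hacc => ?_⟩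
  have hfreq : ∃ᶠ E in nhdsWithin x {x}ᶜ, detFormula E = 0 :=
    (accPt_iff_frequently_nhdsNE.1 hacc).mono fun _ h => h.2
  exact detFormula_one_add_pi_div_two_sq_ne_zero
    (analyticOnNhd_detFormula.eqOn_zero_of_preconnected_of_frequently_eq_zero
      isPreconnected_Ioi hx hfreq hmem)

end
end

section
/- Let N ≥ 1, fix real constants c₁,…,c_N and a bounded sequence (ω^{(n)})_{n∈ℤ} in ℝ^N. Let E ∈ ℂ with Im E ≠ 0. Let J₊(E) be the set of functions f = (f₁,…,f_N) : ℝ → ℂ^N such that: f is continuous on ℝ; on each open interval (n, n+1), n ∈ ℤ, f is twice continuously differentiable and satisfies −f''(x) + V₀·f(x) = E·f(x); at every n ∈ ℤ the one-sided derivatives f_i'(n⁻) and f_i'(n⁺) exist and satisfy f_i'(n⁺) = f_i'(n⁻) + c_i·ω_i^{(n)}·f_i(n) for each i ∈ {1,…,N}; and ∫₀^{+∞} ‖f(x)‖² dx < +∞. Let J₋(E) be defined analogously with the condition ∫_{−∞}^{0} ‖f(x)‖² dx < +∞ instead. Then J₊(E) and J₋(E) are complex vector spaces and dim J₊(E) =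 dim J₋(E) = N. -/
open Matrix MeasureTheory

noncomputable section

/-- The N×N matrix with 1 on the upper and lower diagonals and 0 elsewhere. -/
def V0 (N : ℕ) : Matrix (Fin N) (Fin N) ℝ :=
  Matrix.of fun i j => if |(i : ℤ) - (j : ℤ)| = 1 then 1 else 0

/-- f : ℝ → ℂ^N is a solution of the point interactions eigenvalue problem at
energy E: f is continuous on ℝ, twice continuously differentiable on each
interval (n, n+1) where it satisfies −f'' + V₀·f = E·f, and at every integer n
the one-sided derivatives exist and satisfy the jump condition
f_i'(n⁺) = f_i'(n⁻) + c_i·ω_i^{(n)}·f_i(n). -/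
def SolCond (N : ℕ) (c : Fin N → ℝ) (w : ℤ → Fin N → ℝ) (E : ℂ)
    (f : ℝ → Fin N → ℂ) : Prop :=
  Continuous f ∧
  ∃ f' f'' : ℝ → Fin N → ℂ,
    (∀ n : ℤ, ∀ x ∈ Set.Ioo (n : ℝ) ((n : ℝ) + 1),
        HasDerivAt f (f' x) x ∧ HasDerivAt f' (f'' x) x) ∧
    (∀ n : ℤ, ContinuousOn f'' (Set.Ioo (n : ℝ) ((n : ℝ) + 1))) ∧
    (∀ n : ℤ, ∀ x ∈ Set.Ioo (n : ℝ) ((n : ℝ) + 1),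
        -f'' x + ((V0 N).map (fun r => (r : ℂ))) *ᵥ f x = E • f x) ∧
    (∀ n : ℤ, ∃ L R : Fin N → ℂ,
        HasDerivWithinAt f L (Set.Iio (n : ℝ)) (n : ℝ) ∧
        HasDerivWithinAt f R (Set.Ioi (n : ℝ)) (n : ℝ) ∧
        ∀ i, R i = L i + ((c i * w n i : ℝ) : ℂ) * f (n : ℝ) i)


section Flow

variable {Y : Type*} [NormedAddCommGroup Y] [NormedSpace ℂ Y]

/-- The flow `exp (t A)` of the linear differential equation `u' = A u`. -/
def linFlow (A : Y →L[ℂ] Y) (t : ℝ) : Y →L[ℂ] Y := NormedSpace.exp (t • A)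

variable (A : Y →L[ℂ] Y)

@[simp] lemma linFlow_zero : linFlow A 0 = 1 := by simp [linFlow]

variable [CompleteSpace Y]

lemma linFlow_add (s t : ℝ) : linFlow A (s + t) = linFlow A s * linFlow A t := by
  unfold linFlow
  let _ : NormedAlgebra ℚ (Y →L[ℂ] Y) := NormedAlgebra.restrictScalars ℚ ℂ _
  rw [add_smul, NormedSpace.exp_add_of_commute]
  exact ((Commute.refl A).smul_left s).smul_right t

lemma linFlow_neg_apply_linFlow (t : ℝ) (v : Y) : linFlow A (-t) (linFlow A t v) = v := by
  have h := linFlow_add A (-t) t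
  rw [neg_add_cancel, linFlow_zero] at h
  exact (congrArg (fun B : Y →L[ℂ] Y => B v) h).symm

lemma linFlow_apply_linFlow_neg (t : ℝ) (v : Y) : linFlow A t (linFlow A (-t) v) = v := by
  simpa using linFlow_neg_apply_linFlow A (-t) v

lemma hasDerivAt_linFlow (t : ℝ) : HasDerivAt (linFlow A) (A * linFlow A t) t :=
  hasDerivAt_exp_smul_const' (𝕂 := ℝ) A t

lemma linFlow_commute (t : ℝ) : A * linFlow A t = linFlow A t * A :=
  (hasDerivAt_linFlow A t).unique (hasDerivAt_exp_smul_const (𝕂 := ℝ) A t)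

lemma HasDerivAt.linFlow_apply {u : ℝ → Y} {u' : Y} {t : ℝ} {τ : ℝ → ℝ} {τ' : ℝ}
    (hτ : HasDerivAt τ τ' t) (hu : HasDerivAt u u' t) :
    HasDerivAt (fun x => linFlow A (τ x) (u x))
      (τ' • A (linFlow A (τ t) (u t)) + linFlow A (τ t) u') t := by
  have h := (hasDerivAt_linFlow A (τ t)).scomp t hτ
  let B : (Y →L[ℂ] Y) →L[ℝ] Y →L[ℝ] Y :=
    ContinuousLinearMap.restrictScalarsL ℂ Y Y ℝ ℝ
  have h2 := (B.hasFDerivAt.comp_hasDerivAt t h).clm_apply hu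
  simpa [B] using h2

lemma hasDerivAt_linFlow_sub (a t : ℝ) (v : Y) :
    HasDerivAt (fun x => linFlow A (x - a) v) (A (linFlow A (t - a) v)) t := by
  simpa using HasDerivAt.linFlow_apply A ((hasDerivAt_id t).sub_const a) (hasDerivAt_const t v)

lemma continuous_linFlow_sub (a : ℝ) (v : Y) : Continuous fun x => linFlow A (x - a) v :=
  continuous_iff_continuousAt.2 fun t => (hasDerivAt_linFlow_sub A a t v).continuousAt

lemma exists_eq_linFlow {a b : ℝ} {u : ℝ → Y}
    (hu : ∀ x ∈ Set.Ioo a b, HasDerivAt u (A (u x)) x) :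
    ∃ v, ∀ x ∈ Set.Ioo a b, u x = linFlow A (x - a) v := by
  have key : ∀ x ∈ Set.Ioo a b, HasDerivAt (fun x => linFlow A (a - x) (u x)) 0 x := by
    intro x hx
    have h := HasDerivAt.linFlow_apply A ((hasDerivAt_id x).const_sub a) (hu x hx)
    have hc := congrArg (fun B : Y →L[ℂ] Y => B (u x)) (linFlow_commute A (a - x))
    simp only [mul_apply_eq_comp] at hc
    simpa [hc] using h
  obtain ⟨v, hv⟩ := isOpen_Ioo.exists_is_const_of_deriv_eq_zero isPreconnected_Ioo
    (fun x hx => (key x hx).differentiableAt.differentiableWithinAt)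
    (fun x hx => (key x hx).deriv)
  refine ⟨v, fun x hx => ?_⟩
  rw [← hv x hx, ← neg_sub x a, linFlow_apply_linFlow_neg]

/-- The flow at time `t` as a linear automorphism. -/
def linFlowEquiv (t : ℝ) : Y ≃ₗ[ℂ] Y where
  toLinearMap := (linFlow A t : Y →ₗ[ℂ] Y)
  invFun := linFlow A (-t)
  left_inv := linFlow_neg_apply_linFlow A t
  right_inv := linFlow_apply_linFlow_neg A t

@[simp] lemma linFlowEquiv_apply (t : ℝ) (v : Y) : linFlowEquiv A t v = linFlow A t v := rfl

end Flow

lemma exists_int_propagator {G : Type*} [Group G] (T : ℤ → G) :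
    ∃ P : ℤ → G, P 0 = 1 ∧ ∀ n, P (n + 1) = T n * P n := by
  let p : ℕ → G := fun n => Nat.rec 1 (fun k g => T k * g) n
  let q : ℕ → G := fun n => Nat.rec 1 (fun k g => (T (Int.negSucc k))⁻¹ * g) n
  refine ⟨fun n => Int.casesOn n p fun k => q (k + 1), rfl, fun n => ?_⟩
  match n with
  | Int.ofNat n => rfl
  | Int.negSucc 0 => simp [p, q]; rfl
  | Int.negSucc (k + 1) =>
    have h : Int.negSucc (k + 1) + 1 = Int.negSucc k := by omega
    rw [h]
    change q (k + 1) = T (Int.negSucc (k + 1)) * ((T (Int.negSucc (k + 1)))⁻¹ * q (k + 1))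
    simp

lemma eq_of_int_recursion {G Y : Type*} [Group G] [MulAction G Y] {T : ℤ → G} {u v : ℤ → Y}
    (h0 : u 0 = v 0) (hu : ∀ n, u (n + 1) = T n • u n) (hv : ∀ n, v (n + 1) = T n • v n) (n : ℤ) :
    u n = v n := by
  induction n using Int.induction_on with
  | zero => exact h0
  | succ n ih => rw [hu, hv, ih]
  | pred n ih =>
    have h1 := hu (-n - 1)
    have h2 := hv (-n - 1)
    rw [sub_add_cancel] at h1 h2
    rw [h1, h2] at ih
    exact smul_left_cancel _ ih

section Cauchy

variable {N : ℕ}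

/-- The generator of `-f'' + V₀ f = E f` acting on the Cauchy data `(f, f')`. -/
def cauchyGen (N : ℕ) (E : ℂ) : ((Fin N → ℂ) × (Fin N → ℂ)) →L[ℂ] (Fin N → ℂ) × (Fin N → ℂ) :=
  LinearMap.toContinuousLinearMap <|
    (LinearMap.snd ℂ (Fin N → ℂ) (Fin N → ℂ)).prod
      ((((V0 N).map (fun r => (r : ℂ))).mulVecLin - E • LinearMap.id) ∘ₗ LinearMap.fst ℂ _ _)

@[simp] lemma cauchyGen_fst (E : ℂ) (v : (Fin N → ℂ) × (Fin N → ℂ)) :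
    (cauchyGen N E v).1 = v.2 := rfl

@[simp] lemma cauchyGen_snd (E : ℂ) (v : (Fin N → ℂ) × (Fin N → ℂ)) :
    (cauchyGen N E v).2 = ((V0 N).map (fun r => (r : ℂ))) *ᵥ v.1 - E • v.1 := rfl

/-- The effect on Cauchy data of a point interaction with strengths `r`. -/
def jump (r : Fin N → ℝ) : ((Fin N → ℂ) × (Fin N → ℂ)) ≃ₗ[ℂ] (Fin N → ℂ) × (Fin N → ℂ) where
  toFun v := (v.1, fun i => v.2 i + (r i : ℂ) * v.1 i)
  invFun v := (v.1, fun i => v.2 i - (r i : ℂ) * v.1 i)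
  map_add' u v := by
    ext i
    · simp
    · simp
      ring
  map_smul' a v := by
    ext i
    · simp
    · simp
      ring
  left_inv v := by ext i <;> simp
  right_inv v := by ext i <;> simp

/-- The map sending Cauchy data at `n⁺` to Cauchy data at `(n+1)⁺`. -/
def transfer (c : Fin N → ℝ) (w : ℤ → Fin N → ℝ) (E : ℂ) (n : ℤ) :
    ((Fin N → ℂ) × (Fin N → ℂ)) ≃ₗ[ℂ] (Fin N → ℂ) × (Fin N → ℂ) :=
  jump (fun i => c i * w (n + 1) i) * linFlowEquiv (cauchyGen N E) 1

lemma transfer_apply (c : Fin N → ℝ) (w : ℤ → Fin N → ℝ) (E : ℂ) (n : ℤ)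
    (v : (Fin N → ℂ) × (Fin N → ℂ)) :
    transfer c w E n v = jump (fun i => c i * w (n + 1) i) (linFlow (cauchyGen N E) 1 v) := rfl

/-- `f` is the function whose Cauchy data at `n⁺` is `v n`. -/
def HasCauchyData (E : ℂ) (f : ℝ → Fin N → ℂ) (v : ℤ → (Fin N → ℂ) × (Fin N → ℂ)) : Prop :=
  ∀ n : ℤ, ∀ t ∈ Set.Icc (n : ℝ) (n + 1), f t = (linFlow (cauchyGen N E) (t - n) (v n)).1

variable {c : Fin N → ℝ} {w : ℤ → Fin N → ℝ} {E : ℂ} {f : ℝ → Fin N → ℂ}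
  {v : ℤ → (Fin N → ℂ) × (Fin N → ℂ)}

lemma hasDerivAt_linFlow_fst (a t : ℝ) (v : (Fin N → ℂ) × (Fin N → ℂ)) :
    HasDerivAt (fun x => (linFlow (cauchyGen N E) (x - a) v).1)
      (linFlow (cauchyGen N E) (t - a) v).2 t :=
  (hasDerivAt_linFlow_sub (cauchyGen N E) a t v).fst

lemma hasDerivAt_linFlow_snd (a t : ℝ) (v : (Fin N → ℂ) × (Fin N → ℂ)) :
    HasDerivAt (fun x => (linFlow (cauchyGen N E) (x - a) v).2)
      (cauchyGen N E (linFlow (cauchyGen N E) (t - a) v)).2 t :=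
  (hasDerivAt_linFlow_sub (cauchyGen N E) a t v).snd

lemma HasCauchyData.right_deriv (h : HasCauchyData E f v) (n : ℤ) :
    HasDerivWithinAt f (v n).2 (Set.Ioi (n : ℝ)) n := by
  have h1 := (hasDerivAt_linFlow_fst (E := E) n n (v n)).hasDerivWithinAt (s := Set.Ioi (n : ℝ))
  rw [sub_self, linFlow_zero] at h1
  refine h1.congr_of_eventuallyEq ?_ (h n n (by simp))
  filter_upwards [Ioo_mem_nhdsGT (lt_add_one (n : ℝ))] with x hx
  exact h n x ⟨hx.1.le, hx.2.le⟩

lemma HasCauchyData.left_deriv (h : HasCauchyData E f v) (n : ℤ) :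
    HasDerivWithinAt f (linFlow (cauchyGen N E) 1 (v n)).2 (Set.Iio ((n + 1 : ℤ) : ℝ))
      ((n + 1 : ℤ) : ℝ) := by
  push_cast
  have h1 := (hasDerivAt_linFlow_fst (E := E) n (n + 1) (v n)).hasDerivWithinAt
    (s := Set.Iio ((n : ℝ) + 1))
  rw [add_sub_cancel_left] at h1
  refine h1.congr_of_eventuallyEq ?_ (h n (n + 1) (by simp))
  filter_upwards [Ioo_mem_nhdsLT (lt_add_one (n : ℝ))] with x hx
  exact h n x ⟨hx.1.le, hx.2.le⟩

lemma HasCauchyData.apply_int (h : HasCauchyData E f v) (n : ℤ) : f n = (v n).1 := by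
  simpa using h n n (by simp)

lemma HasCauchyData.apply_int_add_one (h : HasCauchyData E f v) (n : ℤ) :
    f ((n + 1 : ℤ) : ℝ) = (linFlow (cauchyGen N E) 1 (v n)).1 := by
  simpa using h n (n + 1) (by simp)

lemma HasCauchyData.continuous (h : HasCauchyData E f v) : Continuous f := by
  have hl : LocallyFinite fun n : ℤ => Set.Icc (n : ℝ) (n + 1) := by
    intro x
    refine ⟨Set.Ioo (x - 1) (x + 1), Ioo_mem_nhds (by linarith) (by linarith),
      (Set.finite_Icc (⌊x⌋ - 2) (⌊x⌋ + 2)).subset ?_⟩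
    rintro n ⟨y, ⟨h1, h2⟩, h3, h4⟩
    have h5 := Int.floor_le x
    have h6 := Int.lt_floor_add_one x
    constructor
    · have : ((⌊x⌋ - 2 : ℤ) : ℝ) ≤ n := by push_cast; linarith
      exact_mod_cast this
    · have : (n : ℝ) ≤ ((⌊x⌋ + 2 : ℤ) : ℝ) := by push_cast; linarith
      exact_mod_cast this
  refine hl.continuous ?_ (fun n => isClosed_Icc) fun n => ?_
  · refine Set.eq_univ_of_forall fun x => Set.mem_iUnion.2 ⟨⌊x⌋, Int.floor_le x, ?_⟩
    exact (Int.lt_floor_add_one x).le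
  · exact (continuous_linFlow_sub _ _ _).fst.continuousOn.congr (h n)

lemma HasCauchyData.solCond (h : HasCauchyData E f v)
    (hv : ∀ n, v (n + 1) = transfer c w E n (v n)) : SolCond N c w E f := by
  have hfl : ∀ n : ℤ, ∀ x ∈ Set.Ioo (n : ℝ) (n + 1), ⌊x⌋ = n := fun n x hx =>
    Int.floor_eq_iff.2 ⟨hx.1.le, hx.2⟩
  refine ⟨h.continuous, fun x => (linFlow (cauchyGen N E) (x - ⌊x⌋) (v ⌊x⌋)).2,
    fun x => (cauchyGen N E (linFlow (cauchyGen N E) (x - ⌊x⌋) (v ⌊x⌋))).2, ?_, ?_, ?_, ?_⟩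
  · intro n x hx
    have hmem := isOpen_Ioo.mem_nhds hx
    simp only [hfl n x hx]
    constructor
    · refine (hasDerivAt_linFlow_fst _ _ _).congr_of_eventuallyEq ?_
      filter_upwards [hmem] with y hy
      exact h n y ⟨hy.1.le, hy.2.le⟩
    · refine (hasDerivAt_linFlow_snd _ _ _).congr_of_eventuallyEq ?_
      filter_upwards [hmem] with y hy
      rw [hfl n y hy]
  · intro n
    refine ContinuousOn.congr (f := fun x =>
      (cauchyGen N E (linFlow (cauchyGen N E) (x - n) (v n))).2) ?_ ?_
    · exact ((cauchyGen N E).continuous.comp (continuous_linFlow_sub _ _ _)).snd.continuousOn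
    · intro x hx
      simp only [hfl n x hx]
  · intro n x hx
    simp only [hfl n x hx, cauchyGen_snd, h n x ⟨hx.1.le, hx.2.le⟩]
    abel
  · intro n
    obtain ⟨m, rfl⟩ : ∃ m, n = m + 1 := ⟨n - 1, by ring⟩
    refine ⟨_, _, h.left_deriv m, h.right_deriv (m + 1), fun i => ?_⟩
    rw [hv, transfer_apply, h.apply_int_add_one]
    simp [jump]

lemma SolCond.exists_hasCauchyData (h : SolCond N c w E f) :
    ∃ v, HasCauchyData E f v ∧ ∀ n, v (n + 1) = transfer c w E n (v n) := by
  obtain ⟨hc, f', f'', hd, -, heq, hj⟩ := h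
  have key : ∀ n : ℤ, ∃ v, ∀ x ∈ Set.Ioo (n : ℝ) (n + 1),
      (f x, f' x) = linFlow (cauchyGen N E) (x - n) v := by
    intro n
    refine exists_eq_linFlow (u := fun x => (f x, f' x)) _ fun x hx => ?_
    have : cauchyGen N E (f x, f' x) = (f' x, f'' x) := by
      refine Prod.ext rfl ?_
      rw [cauchyGen_snd, ← heq n x hx]
      simp
    rw [this]
    exact (hd n x hx).1.prodMk (hd n x hx).2
  choose v hv using key
  have hfv : HasCauchyData E f v := by
    intro n
    refine Set.EqOn.of_subset_closure (s := Set.Ioo (n : ℝ) (n + 1)) ?_ hc.continuousOn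
      (continuous_linFlow_sub _ _ _).fst.continuousOn Set.Ioo_subset_Icc_self ?_
    · intro x hx
      exact congrArg Prod.fst (hv n x hx)
    · rw [closure_Ioo (by simp)]
  refine ⟨v, hfv, fun n => ?_⟩
  obtain ⟨L, R, hL, hR, hLR⟩ := hj (n + 1)
  have h1 := (uniqueDiffWithinAt_Iio _).eq_deriv _ hL (hfv.left_deriv n)
  have h2 := (uniqueDiffWithinAt_Ioi _).eq_deriv _ hR (hfv.right_deriv (n + 1))
  refine Prod.ext ?_ ?_
  · rw [← hfv.apply_int, hfv.apply_int_add_one]; rfl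
  · rw [← h2]
    funext i
    rw [hLR, h1, hfv.apply_int_add_one]
    simp [transfer_apply, jump]

end Cauchy

lemma exists_coercive {Y : Type*} [NormedAddCommGroup Y] [NormedSpace ℝ Y] [ProperSpace Y]
    {q : Y → ℝ} (hq : Continuous q) (hom : ∀ (r : ℝ) v, q (r • v) = r ^ 2 * q v)
    (pos : ∀ v, v ≠ 0 → 0 < q v) : ∃ κ > 0, ∀ v, κ * ‖v‖ ^ 2 ≤ q v := by
  have h0 : q 0 = 0 := by simpa using hom 0 0
  rcases (Metric.sphere (0 : Y) 1).eq_empty_or_nonempty with he | hne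
  · refine ⟨1, one_pos, fun v => ?_⟩
    by_cases hv : v = 0
    · simp [hv, h0]
    · exact absurd (he ▸ (by simp [norm_smul, hv] : ‖v‖⁻¹ • v ∈ Metric.sphere (0 : Y) 1))
        (Set.notMem_empty _)
  · obtain ⟨u, hu, hmin⟩ := (isCompact_sphere (0 : Y) 1).exists_isMinOn hne hq.continuousOn
    have hu0 : u ≠ 0 := by
      rintro rfl
      simp at hu
    refine ⟨q u, pos u hu0, fun v => ?_⟩
    by_cases hv : v = 0
    · simp [hv, h0]
    · have h1 : q u ≤ q (‖v‖⁻¹ • v) := hmin (by simp [norm_smul, hv])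
      have h2 := hom ‖v‖ (‖v‖⁻¹ • v)
      rw [smul_inv_smul₀ (norm_ne_zero_iff.2 hv)] at h2
      rw [h2, mul_comm]
      gcongr

/-- If `S` decreases coercively along the propagators `P n` and is nonnegative on the graph of a
linear map, then every `a` is the first component of a datum along which `S` stays nonnegative. -/
lemma exists_forall_nonneg_of_coercive {X : Type*} [NormedAddCommGroup X] [NormedSpace ℂ X]
    [FiniteDimensional ℂ X] {S : X × X → ℝ} (hS : Continuous S) {C : ℝ}
    (hC : ∀ v, S v ≤ C * ‖v.1‖ * ‖v‖) {P : ℕ → (X × X) ≃ₗ[ℂ] X × X} (hP : P 0 = 1) {κ : ℝ}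
    (hκ : 0 < κ) (hdec : ∀ n v, κ * ‖P n v‖ ^ 2 ≤ S (P n v) - S (P (n + 1) v))
    (L : X →ₗ[ℂ] X) (hL : ∀ a, 0 ≤ S (a, L a)) (a : X) :
    ∃ b, ∀ n, 0 ≤ S (P n (a, b)) := by
  have hanti : ∀ v, Antitone fun n => S (P n v) := fun v =>
    antitone_nat_of_succ_le fun n => by
      have := hdec n v
      have : 0 ≤ κ * ‖P n v‖ ^ 2 := by positivity
      linarith
  have hbound : ∀ v, 0 ≤ S (P 1 v) → κ * ‖v‖ ≤ C * ‖v.1‖ := by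
    intro v hv
    have h1 := hdec 0 v
    have h2 := hC v
    rw [zero_add] at h1
    simp only [hP, LinearEquiv.coe_one, id] at h1
    rcases eq_or_ne v 0 with rfl | hv0
    · simp
    · have h3 : 0 < ‖v‖ := norm_pos_iff.2 hv0
      refine le_of_mul_le_mul_right ?_ h3
      nlinarith
  have hex : ∀ m, ∃ v : X × X, v.1 = a ∧ 0 ≤ S (P (m + 1) v) := by
    intro m
    let g : X →ₗ[ℂ] X := LinearMap.fst ℂ X X ∘ₗ ((P (m + 1)).symm : (X × X) →ₗ[ℂ] X × X) ∘ₗ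
      LinearMap.id.prod L
    have hpos : ∀ x, 0 ≤ S (P (m + 1) ((P (m + 1)).symm (x, L x))) := fun x => by
      simpa using hL x
    have hinj : Function.Injective g := by
      refine (injective_iff_map_eq_zero g).2 fun x hx => ?_
      have h1 := hbound _ ((hpos x).trans (hanti _ (by omega : 1 ≤ m + 1)))
      have h2 : ((P (m + 1)).symm (x, L x)).1 = 0 := hx
      rw [h2, norm_zero, mul_zero] at h1
      have h3 : ‖(P (m + 1)).symm (x, L x)‖ ≤ 0 := by
        by_contra! h
        nlinarith
      have h4 := (LinearEquiv.map_eq_zero_iff _).1 (norm_le_zero_iff.1 h3)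
      exact congrArg Prod.fst h4
    obtain ⟨x, hx⟩ := LinearMap.injective_iff_surjective.1 hinj a
    exact ⟨_, hx, hpos x⟩
  have hPc : ∀ m, Continuous (P m) := fun m =>
    LinearMap.continuous_of_finiteDimensional ((P m : (X × X) →ₗ[ℂ] X × X))
  have hclosed : ∀ m, IsClosed {v : X × X | v.1 = a ∧ 0 ≤ S (P (m + 1) v)} := fun m =>
    (isClosed_eq continuous_fst continuous_const).inter
      (isClosed_le continuous_const (hS.comp (hPc _)))
  have : ProperSpace (X × X) := FiniteDimensional.proper ℂ _
  obtain ⟨v, hv⟩ := IsCompact.nonempty_iInter_of_sequence_nonempty_isCompact_isClosed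
    (fun m => {v : X × X | v.1 = a ∧ 0 ≤ S (P (m + 1) v)})
    (fun m v hv => ⟨hv.1, hv.2.trans (hanti v (Nat.le_succ _))⟩) hex
    ((isCompact_closedBall (0 : X × X) (C * ‖a‖ / κ)).of_isClosed_subset (hclosed 0)
      fun v hv => by
        rw [mem_closedBall_zero_iff, le_div_iff₀ hκ, mul_comm, ← hv.1]
        exact hbound v hv.2) hclosed
  simp only [Set.mem_iInter, Set.mem_ofPred_eq] at hv
  refine ⟨v.2, fun n => ?_⟩
  have : (a, v.2) = v := by rw [← (hv 0).1]
  rw [this]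
  exact (hv n).2.trans (hanti v (Nat.le_succ n))

section Krein

variable {N : ℕ}

/-- The indefinite Hermitian form `Im E · Im ⟨f, f'⟩` on Cauchy data. -/
def krein (E : ℂ) (v : (Fin N → ℂ) × (Fin N → ℂ)) : ℝ := E.im * (star v.1 ⬝ᵥ v.2).im

lemma continuous_krein (E : ℂ) : Continuous (krein (N := N) E) := by
  unfold krein dotProduct
  simp only [Pi.star_apply]
  fun_prop

lemma krein_smul (E : ℂ) (r : ℝ) (v : (Fin N → ℂ) × (Fin N → ℂ)) :
    krein E (r • v) = r ^ 2 * krein E v := by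
  simp [krein]
  ring

lemma krein_jump (E : ℂ) (r : Fin N → ℝ) (v : (Fin N → ℂ) × (Fin N → ℂ)) :
    krein E (jump r v) = krein E v := by
  simp only [krein, jump, LinearEquiv.coe_mk, LinearMap.coe_mk, AddHom.coe_mk, dotProduct,
    Complex.im_sum]
  congr 1
  refine Finset.sum_congr rfl fun i _ => ?_
  simp
  ring

lemma abs_krein_le (E : ℂ) (v : (Fin N → ℂ) × (Fin N → ℂ)) :
    |krein E v| ≤ |E.im| * N * ‖v.1‖ * ‖v‖ := by
  rw [krein, abs_mul, mul_assoc, mul_assoc]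
  gcongr
  refine (Complex.abs_im_le_norm _).trans ((norm_sum_le _ _).trans ?_)
  have : ∀ i ∈ Finset.univ, ‖star v.1 i * v.2 i‖ ≤ ‖v.1‖ * ‖v‖ := fun i _ => by
    rw [norm_mul, Pi.star_apply, norm_star]
    exact mul_le_mul (norm_le_pi_norm _ i) ((norm_le_pi_norm _ i).trans (norm_snd_le v))
      (norm_nonneg _) (norm_nonneg _)
  simpa using Finset.sum_le_sum this

lemma star_dotProduct_self_eq (a : Fin N → ℂ) : star a ⬝ᵥ a = ((∑ i, ‖a i‖ ^ 2 : ℝ) : ℂ) := by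
  simp [dotProduct, Complex.conj_mul']

lemma V0_map_isHermitian : ((V0 N).map (fun r => (r : ℂ))).IsHermitian := by
  ext i j
  simp [V0, abs_sub_comm]

lemma hasDerivAt_krein_linFlow (E : ℂ) (a t : ℝ) (v : (Fin N → ℂ) × (Fin N → ℂ)) :
    HasDerivAt (fun x => krein E (linFlow (cauchyGen N E) (x - a) v))
      (-(E.im ^ 2 * ∑ i, ‖(linFlow (cauchyGen N E) (t - a) v).1 i‖ ^ 2)) t := by
  have h1 := hasDerivAt_pi.1 (hasDerivAt_linFlow_fst (E := E) a t v)
  have h2 := hasDerivAt_pi.1 (hasDerivAt_linFlow_snd (E := E) a t v)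
  have h3 := HasDerivAt.fun_sum (u := Finset.univ) fun i _ => (h1 i).star.mul (h2 i)
  have h4 := (Complex.imCLM.hasFDerivAt.comp_hasDerivAt t h3).const_mul E.im
  refine h4.congr_deriv ?_
  set u := linFlow (cauchyGen N E) (t - a) v
  have h5 : ∑ i, (star (u.2 i) * u.2 i + star (u.1 i) * (cauchyGen N E u).2 i) =
      star u.2 ⬝ᵥ u.2 + (star u.1 ⬝ᵥ (((V0 N).map (fun r => (r : ℂ))) *ᵥ u.1)
        - E * (star u.1 ⬝ᵥ u.1)) := by
    rw [Finset.sum_add_distrib, ← smul_eq_mul E, ← dotProduct_smul, ← dotProduct_sub]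
    rfl
  have h6 : (star u.1 ⬝ᵥ (((V0 N).map (fun r => (r : ℂ))) *ᵥ u.1)).im = 0 :=
    V0_map_isHermitian.im_star_dotProduct_mulVec_self u.1
  rw [h5, Complex.imCLM_apply, Complex.add_im, Complex.sub_im, h6, star_dotProduct_self_eq,
    star_dotProduct_self_eq, Complex.ofReal_im, Complex.im_mul_ofReal]
  ring

lemma intervalIntegral_linFlow (E : ℂ) (a : ℝ) (v : (Fin N → ℂ) × (Fin N → ℂ)) :
    E.im ^ 2 * ∫ x in a..(a + 1), ∑ i, ‖(linFlow (cauchyGen N E) (x - a) v).1 i‖ ^ 2 =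
      krein E v - krein E (linFlow (cauchyGen N E) 1 v) := by
  have hc := (continuous_linFlow_sub (cauchyGen N E) a v)
  have h := intervalIntegral.integral_eq_sub_of_hasDerivAt (a := a) (b := a + 1)
    (fun x _ => hasDerivAt_krein_linFlow E a x v)
    (Continuous.intervalIntegrable (by fun_prop) _ _)
  rw [intervalIntegral.integral_neg, intervalIntegral.integral_const_mul] at h
  simp only [add_sub_cancel_left, sub_self, linFlow_zero] at h
  change _ = krein E ((1 : _ →L[ℂ] _) v) - _
  linarith

lemma krein_linFlow_one_lt {E : ℂ} (hE : E.im ≠ 0) {v : (Fin N → ℂ) × (Fin N → ℂ)}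
    (hv : v ≠ 0) : 0 < krein E v - krein E (linFlow (cauchyGen N E) 1 v) := by
  rw [← intervalIntegral_linFlow E 0 v]
  have hc := (continuous_linFlow_sub (cauchyGen N E) 0 v)
  refine mul_pos (by positivity) (intervalIntegral.integral_pos (by simp)
    (Continuous.continuousOn (by fun_prop)) (fun x _ => by positivity) ?_)
  by_contra! hzero
  have hz : ∀ x ∈ Set.Ioo (0 : ℝ) 1, (linFlow (cauchyGen N E) (x - 0) v).1 = 0 := by
    intro x hx
    have h1 := hzero x ⟨hx.1.le, by linarith [hx.2]⟩
    have h2 := (Finset.sum_eq_zero_iff_of_nonneg (fun i _ => by positivity)).1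
      (h1.antisymm (by positivity))
    funext i
    simpa using h2 i (Finset.mem_univ i)
  have hmem : Set.Ioo (0 : ℝ) 1 ∈ nhds (1 / 2 : ℝ) := Ioo_mem_nhds (by norm_num) (by norm_num)
  have hd : HasDerivAt (fun x => (linFlow (cauchyGen N E) (x - 0) v).1) 0 (1 / 2 : ℝ) :=
    (hasDerivAt_const _ (0 : Fin N → ℂ)).congr_of_eventuallyEq
      (Filter.mem_of_superset hmem hz)
  have h0 : linFlow (cauchyGen N E) (1 / 2 - 0) v = 0 :=
    Prod.ext (hz _ (mem_of_mem_nhds hmem)) ((hasDerivAt_linFlow_fst 0 (1 / 2) v).unique hd)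
  exact hv ((LinearEquiv.map_eq_zero_iff (linFlowEquiv (cauchyGen N E) (1 / 2 - 0))).1 h0)

lemma exists_krein_coercive {E : ℂ} (hE : E.im ≠ 0) :
    ∃ κ > 0, ∀ v : (Fin N → ℂ) × (Fin N → ℂ),
      κ * ‖v‖ ^ 2 ≤ krein E v - krein E (linFlow (cauchyGen N E) 1 v) := by
  refine exists_coercive ?_ (fun r v => ?_) fun v hv => krein_linFlow_one_lt hE hv
  · exact (continuous_krein E).sub
      ((continuous_krein E).comp (linFlow (cauchyGen N E) 1).continuous)
  · have : linFlow (cauchyGen N E) 1 (r • v) = r • linFlow (cauchyGen N E) 1 v :=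
      (linFlow (cauchyGen N E) 1).map_smul_of_tower r v
    rw [this, krein_smul, krein_smul]
    ring

variable {c : Fin N → ℝ} {w : ℤ → Fin N → ℝ} {E : ℂ} {f : ℝ → Fin N → ℂ}
  {v : ℤ → (Fin N → ℂ) × (Fin N → ℂ)}

lemma krein_transfer (n : ℤ) (v : (Fin N → ℂ) × (Fin N → ℂ)) :
    krein E (transfer c w E n v) = krein E (linFlow (cauchyGen N E) 1 v) := by
  rw [transfer_apply, krein_jump]

lemma HasCauchyData.intervalIntegral_eq (h : HasCauchyData E f v)
    (hv : ∀ n, v (n + 1) = transfer c w E n (v n)) (m : ℕ) :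
    E.im ^ 2 * ∫ x in (0 : ℝ)..m, ∑ i, ‖f x i‖ ^ 2 = krein E (v 0) - krein E (v m) := by
  have hc := h.continuous
  have hint : ∀ a b : ℝ, IntervalIntegrable (fun x => ∑ i, ‖f x i‖ ^ 2) volume a b := fun a b =>
    Continuous.intervalIntegrable (by fun_prop) _ _
  induction m with
  | zero => simp
  | succ m ih =>
    push_cast
    rw [← intervalIntegral.integral_add_adjacent_intervals (hint 0 m) (hint m (m + 1)), mul_add, ih,
      hv, krein_transfer]
    have h1 := intervalIntegral_linFlow E m (v m)
    have h2 : ∫ x in (m : ℝ)..(m + 1), ∑ i, ‖f x i‖ ^ 2 =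
        ∫ x in (m : ℝ)..(m + 1), ∑ i, ‖(linFlow (cauchyGen N E) (x - m) (v m)).1 i‖ ^ 2 := by
      refine intervalIntegral.integral_congr fun x hx => ?_
      rw [Set.uIcc_of_le (by simp)] at hx
      have := h m x (by simpa using hx)
      simp [this]
    rw [h2, h1]
    ring

lemma HasCauchyData.integrableOn_iff (hE : E.im ≠ 0) (h : HasCauchyData E f v)
    (hv : ∀ n, v (n + 1) = transfer c w E n (v n)) :
    IntegrableOn (fun x => ∑ i, ‖f x i‖ ^ 2) (Set.Ioi (0 : ℝ)) ↔
      ∀ n : ℕ, 0 ≤ krein E (v n) := by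
  have hc := h.continuous
  have hE2 : 0 < E.im ^ 2 := by positivity
  have hstep : ∀ n : ℕ, krein E (v n) - krein E (v (n + 1 : ℕ)) =
      krein E (v n) - krein E (linFlow (cauchyGen N E) 1 (v n)) := fun n => by
    push_cast
    rw [hv, krein_transfer]
  constructor
  · intro hi
    obtain ⟨κ, hκ, hco⟩ := exists_krein_coercive (N := N) hE
    have h1 := (intervalIntegral_tendsto_integral_Ioi 0 hi
      tendsto_natCast_atTop_atTop).const_mul (E.im ^ 2)
    simp only [h.intervalIntegral_eq hv] at h1
    have h2 := h1.const_sub (krein E (v 0))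
    simp only [sub_sub_cancel] at h2
    have h3 := h2.sub ((Filter.tendsto_add_atTop_iff_nat 1).2 h2)
    rw [sub_self] at h3
    have h4 : Filter.Tendsto (fun n : ℕ => ‖v n‖ ^ 2) Filter.atTop (nhds 0) := by
      refine squeeze_zero (fun n => by positivity) (fun n => ?_) (by simpa using h3.const_mul κ⁻¹)
      rw [le_inv_mul_iff₀ hκ]
      refine le_of_le_of_eq ?_ (hstep n).symm
      exact hco _
    have h5 : Filter.Tendsto (fun n : ℕ => krein E (v n)) Filter.atTop (nhds 0) := by
      refine squeeze_zero_norm (fun n => ?_) (by simpa using h4.const_mul (|E.im| * N))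
      refine (abs_krein_le E (v n)).trans ?_
      rw [mul_assoc, sq]
      gcongr
      exact norm_fst_le _
    refine Antitone.le_of_tendsto (antitone_nat_of_succ_le fun n => ?_) h5
    rw [← sub_nonneg, hstep]
    exact (by positivity : 0 ≤ κ * ‖v n‖ ^ 2).trans (hco _)
  · intro hpos
    refine integrableOn_Ioi_of_intervalIntegral_norm_bounded (krein E (v 0) / E.im ^ 2) 0
      (fun m : ℕ => Continuous.integrableOn_Ioc (by fun_prop)) tendsto_natCast_atTop_atTop
      (Filter.Eventually.of_forall fun m => ?_)
    have h1 : ∀ x, ‖∑ i, ‖f x i‖ ^ 2‖ = ∑ i, ‖f x i‖ ^ 2 := fun x =>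
      Real.norm_of_nonneg (by positivity)
    simp only [h1]
    rw [le_div_iff₀' hE2, h.intervalIntegral_eq hv]
    linarith [hpos m]

end Krein

section SolutionSpace

variable {N : ℕ} {c : Fin N → ℝ} {w : ℤ → Fin N → ℝ} {E : ℂ} {f : ℝ → Fin N → ℂ}

/-- The solution whose Cauchy data at `n⁺` is `P n v`, as a linear function of `v`. -/
def solOfData (E : ℂ) (P : ℤ → (((Fin N → ℂ) × (Fin N → ℂ)) ≃ₗ[ℂ] (Fin N → ℂ) × (Fin N → ℂ))) :
    ((Fin N → ℂ) × (Fin N → ℂ)) →ₗ[ℂ] ℝ → Fin N → ℂ where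
  toFun v t := (linFlow (cauchyGen N E) (t - ⌊t⌋) (P ⌊t⌋ v)).1
  map_add' u v := by
    ext
    simp
  map_smul' a v := by
    ext
    simp

variable {P : ℤ → (((Fin N → ℂ) × (Fin N → ℂ)) ≃ₗ[ℂ] (Fin N → ℂ) × (Fin N → ℂ))}

lemma hasCauchyData_solOfData (hP : ∀ n, P (n + 1) = transfer c w E n * P n)
    (v : (Fin N → ℂ) × (Fin N → ℂ)) :
    HasCauchyData E (solOfData E P v) fun n => P n v := by
  intro n t ht
  change (linFlow (cauchyGen N E) (t - ⌊t⌋) (P ⌊t⌋ v)).1 = _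
  rcases ht.2.lt_or_eq with h | rfl
  · rw [Int.floor_eq_iff.2 ⟨ht.1, h⟩]
  · have h1 : ⌊(n : ℝ) + 1⌋ = n + 1 := by simp
    rw [h1, hP]
    simp [transfer_apply, jump]

lemma solCond_iff_mem_range (hP0 : P 0 = 1) (hP : ∀ n, P (n + 1) = transfer c w E n * P n) :
    SolCond N c w E f ↔ f ∈ (solOfData E P).range := by
  constructor
  · intro h
    obtain ⟨v, hfv, hv⟩ := h.exists_hasCauchyData
    refine ⟨v 0, funext fun t => ?_⟩
    have ht : t ∈ Set.Icc (⌊t⌋ : ℝ) (⌊t⌋ + 1) := ⟨Int.floor_le t, (Int.lt_floor_add_one t).le⟩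
    have h1 : v ⌊t⌋ = P ⌊t⌋ (v 0) :=
      eq_of_int_recursion (T := transfer c w E) (v := fun n => P n (v 0)) (by simp [hP0]) hv
        (fun n => by rw [hP]; rfl) _
    rw [hasCauchyData_solOfData hP _ _ t ht, hfv _ t ht, h1]
  · rintro ⟨v, rfl⟩
    exact (hasCauchyData_solOfData hP v).solCond fun n => by rw [hP]; rfl

/-- The functions which are square-integrable on `s`. -/
def squareIntegrableOn (N : ℕ) (s : Set ℝ) : Submodule ℂ (ℝ → Fin N → ℂ) where
  carrier := {f | ∀ i, MemLp (fun x => f x i) 2 (volume.restrict s)}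
  zero_mem' _ := MemLp.zero'
  add_mem' hf hg i := (hf i).add (hg i)
  smul_mem' a _ hf i := (hf i).const_smul a

lemma mem_squareIntegrableOn_iff (hf : Continuous f) {s : Set ℝ} :
    f ∈ squareIntegrableOn N s ↔ IntegrableOn (fun x => ∑ i, ‖f x i‖ ^ 2) s := by
  have h : f ∈ squareIntegrableOn N s ↔ ∀ i, IntegrableOn (fun x => ‖f x i‖ ^ 2) s :=
    forall_congr' fun i => memLp_two_iff_integrable_sq_norm
      (Continuous.aestronglyMeasurable (by fun_prop))
  rw [h]
  refine ⟨fun hi => integrable_finsetSum _ fun i _ => hi i, fun hi i => ?_⟩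
  refine Integrable.mono hi (Continuous.aestronglyMeasurable (by fun_prop)) (ae_of_all _ fun x => ?_)
  rw [Real.norm_of_nonneg (by positivity), Real.norm_of_nonneg (by positivity)]
  exact Finset.single_le_sum (f := fun i => ‖f x i‖ ^ 2) (fun i _ => by positivity)
    (Finset.mem_univ i)

theorem exists_submodule_solCond_Ioi (c : Fin N → ℝ) (w : ℤ → Fin N → ℝ) (hE : E.im ≠ 0) :
    ∃ Vp : Submodule ℂ (ℝ → Fin N → ℂ),
      (Vp : Set (ℝ → Fin N → ℂ)) =
        {f | SolCond N c w E f ∧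
          IntegrableOn (fun x => ∑ i, ‖f x i‖ ^ 2) (Set.Ioi (0 : ℝ))} ∧
      Module.finrank ℂ Vp = N := by
  obtain ⟨P, hP0, hP⟩ := exists_int_propagator (transfer c w E)
  have hstep : ∀ n v, P (n + 1) v = transfer c w E n (P n v) := fun n v => by rw [hP]; rfl
  have hsol : ∀ v, SolCond N c w E (solOfData E P v) := fun v =>
    (solCond_iff_mem_range hP0 hP).2 ⟨v, rfl⟩
  obtain ⟨κ, hκ, hco⟩ := exists_krein_coercive (N := N) hE
  have hmem : ∀ v, solOfData E P v ∈ squareIntegrableOn N (Set.Ioi 0) ↔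
      ∀ n : ℕ, 0 ≤ krein E (P n v) := fun v => by
    rw [mem_squareIntegrableOn_iff (hsol v).1]
    have hv : ∀ n, (fun n => P n v) (n + 1) = transfer c w E n ((fun n => P n v) n) :=
      fun n => hstep n v
    have h := (hasCauchyData_solOfData hP v).integrableOn_iff hE hv
    exact h
  have hzero : ∀ v, solOfData E P v 0 = v.1 := fun v => by
    have := (hasCauchyData_solOfData hP v).apply_int 0
    simpa [hP0] using this
  refine ⟨(solOfData E P).range ⊓ squareIntegrableOn N (Set.Ioi 0), ?_, ?_⟩
  · ext f
    refine (and_congr_left' (solCond_iff_mem_range hP0 hP).symm).trans ?_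
    exact and_congr_right fun h => mem_squareIntegrableOn_iff h.1
  · let ev : ((solOfData E P).range ⊓ squareIntegrableOn N (Set.Ioi 0) :
        Submodule ℂ (ℝ → Fin N → ℂ)) →ₗ[ℂ] Fin N → ℂ :=
      LinearMap.proj 0 ∘ₗ Submodule.subtype _
    have hinj : Function.Injective ev := by
      refine (injective_iff_map_eq_zero ev).2 ?_
      rintro ⟨_, ⟨v, rfl⟩, hv⟩ hv0
      have hv1 : v.1 = 0 := (hzero v).symm.trans hv0
      have h1 := (hmem v).1 hv 1
      have h2 := hco v
      have h3 := hstep 0 v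
      have h4 : krein E v = 0 := by simp [krein, hv1]
      rw [zero_add, hP0] at h3
      rw [Nat.cast_one, h3, krein_transfer] at h1
      change 0 ≤ krein E (linFlow (cauchyGen N E) 1 v) at h1
      have h5 : v = 0 := by
        by_contra hne
        have : 0 < κ * ‖v‖ ^ 2 := by positivity
        linarith
      exact Subtype.ext (by simp [h5])
    have hsurj : Function.Surjective ev := by
      intro a
      obtain ⟨b, hb⟩ := exists_forall_nonneg_of_coercive (continuous_krein E)
        (fun v => (le_abs_self _).trans (abs_krein_le E v)) (P := fun n : ℕ => P n) hP0 hκ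
        (fun n v => by
          push_cast
          rw [hstep, krein_transfer]
          exact hco _)
        ((E.im * Complex.I) • LinearMap.id) (fun a => by
          have : 0 ≤ E.im ^ 2 * ∑ i, ‖a i‖ ^ 2 := by positivity
          rw [krein, LinearMap.smul_apply, LinearMap.id_apply, dotProduct_smul,
            star_dotProduct_self_eq, smul_eq_mul, Complex.im_mul_ofReal, Complex.im_ofReal_mul,
            Complex.I_im]
          linarith) a
      exact ⟨⟨solOfData E P (a, b), ⟨_, rfl⟩, (hmem _).2 hb⟩, hzero _⟩
    rw [(LinearEquiv.ofBijective ev ⟨hinj, hsurj⟩).finrank_eq]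
    simp

lemma SolCond.comp_neg (h : SolCond N c w E f) :
    SolCond N c (fun n => w (-n)) E fun x => f (-x) := by
  obtain ⟨hc, f', f'', hd, hcont, heq, hj⟩ := h
  have hmem : ∀ n : ℤ, ∀ x ∈ Set.Ioo (n : ℝ) (n + 1),
      -x ∈ Set.Ioo ((-n - 1 : ℤ) : ℝ) ((-n - 1 : ℤ) + 1) := fun n x hx => by
    push_cast
    exact ⟨by linarith [hx.2], by linarith [hx.1]⟩
  refine ⟨by fun_prop, fun x => -f' (-x), fun x => f'' (-x), fun n x hx => ?_, fun n => ?_,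
    fun n x hx => heq _ _ (hmem n x hx), fun n => ?_⟩
  · obtain ⟨h1, h2⟩ := hd _ _ (hmem n x hx)
    exact ⟨(h1.scomp x (hasDerivAt_neg x)).congr_deriv (by simp),
      (h2.scomp x (hasDerivAt_neg x)).fun_neg.congr_deriv (by simp)⟩
  · exact (hcont (-n - 1)).comp continuous_neg.continuousOn (hmem n)
  · obtain ⟨L, R, hL, hR, hLR⟩ := hj (-n)
    push_cast at hL hR hLR
    refine ⟨-R, -L, ?_, ?_, fun i => ?_⟩
    · exact (hR.scomp (n : ℝ) (hasDerivAt_neg (n : ℝ)).hasDerivWithinAt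
        fun x (hx : x < n) => neg_lt_neg hx).congr_deriv (by simp)
    · exact (hL.scomp (n : ℝ) (hasDerivAt_neg (n : ℝ)).hasDerivWithinAt
        fun x (hx : (n : ℝ) < x) => neg_lt_neg hx).congr_deriv (by simp)
    · simp [hLR]

end SolutionSpace

/-- for nonreal E, the sets J₊(E) and J₋(E) of solutions which are
square-integrable near +∞ (resp. −∞) are complex vector spaces of dimension N. -/
theorem dim_Jplus_Jminus (N : ℕ) (hN : 1 ≤ N) (c : Fin N → ℝ)
    (w : ℤ → Fin N → ℝ) (hw : ∃ Cb : ℝ, ∀ n i, |w n i| ≤ Cb)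
    (E : ℂ) (hE : E.im ≠ 0) :
    (∃ Vp : Submodule ℂ (ℝ → Fin N → ℂ),
      (Vp : Set (ℝ → Fin N → ℂ)) =
        {f | SolCond N c w E f ∧
          IntegrableOn (fun x => ∑ i, ‖f x i‖ ^ 2) (Set.Ioi (0 : ℝ))} ∧
      Module.finrank ℂ Vp = N) ∧
    (∃ Vm : Submodule ℂ (ℝ → Fin N → ℂ),
      (Vm : Set (ℝ → Fin N → ℂ)) =
        {f | SolCond N c w E f ∧
          IntegrableOn (fun x => ∑ i, ‖f x i‖ ^ 2) (Set.Iio (0 : ℝ))} ∧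
      Module.finrank ℂ Vm = N) := by
  refine ⟨exists_submodule_solCond_Ioi c w hE, ?_⟩
  obtain ⟨Vp, hVp, hrank⟩ := exists_submodule_solCond_Ioi (N := N) c (fun n => w (-n)) hE
  let e := LinearEquiv.funCongrLeft ℂ (Fin N → ℂ) (Equiv.neg ℝ)
  refine ⟨Vp.map (e : (ℝ → Fin N → ℂ) →ₗ[ℂ] ℝ → Fin N → ℂ), ?_, ?_⟩
  · ext f
    constructor
    · rintro ⟨g, hg, rfl⟩
      rw [hVp] at hg
      have h := hg.1.comp_neg
      simp only [neg_neg] at h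
      refine ⟨h, ?_⟩
      exact IntegrableOn.comp_neg_Iio (c := (0 : ℝ)) (f := fun x => ∑ i, ‖g x i‖ ^ 2)
        (by simpa using hg.2)
    · rintro ⟨hf, hi⟩
      refine ⟨fun x => f (-x), ?_, funext fun x => congrArg f (neg_neg x)⟩
      rw [hVp]
      exact ⟨hf.comp_neg, IntegrableOn.comp_neg_Ioi (c := (0 : ℝ))
        (f := fun x => ∑ i, ‖f x i‖ ^ 2) (by simpa using hi)⟩
  · rw [LinearEquiv.finrank_map_eq, hrank]

end
end
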